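/- Under the Tobit model, if E[‖X‖²] < ∞ and the K×K matrix E[X Xᵀ] is nonsingular, then the (K+1)×(K+1) matrix E[ H(Y, X, D; δ₀, γ₀) ] is nonsingular. (This verifies the nonsingularity condition for asymptotic normality of the conditional ML estimator in the Tobit model.) -/

import Mathlib

open MeasureTheory ProbabilityTheory Real Filter Set

noncomputable section

/-- The standard normal density `φ`. -/
def gPDF (t : ℝ) : ℝ := (Real.sqrt (2 * Real.pi))⁻¹ * Real.exp (-t ^ 2 / 2)

/-- The standard normal cumulative distribution function `Φ`. -/
def gCDF (t : ℝ) : ℝ := ∫ s in Set.Iic t, gPDF s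

/-- The inverse Mills ratio `λ(v) = φ(v)/(1 - Φ(v))`. -/
def mills (v : ℝ) : ℝ := gPDF v / (1 - gCDF v)

/-- Euclidean norm of a vector in `ℝ^n`. -/
def vnorm {n : ℕ} (x : Fin n → ℝ) : ℝ := Real.sqrt (∑ i, (x i) ^ 2)

/-- Frobenius (Euclidean) norm of a real matrix. -/
def frob {m n : Type*} [Fintype m] [Fintype n] (M : Matrix m n ℝ) : ℝ :=
  Real.sqrt (∑ i, ∑ j, (M i j) ^ 2)

/-- Dot product `xᵀδ`. -/
def dotp {n : ℕ} (x δ : Fin n → ℝ) : ℝ := ∑ i, x i * δ i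

/-- The block matrix `[[x xᵀ, -y·x], [-y·xᵀ, γ⁻² + y²]]`. -/
def blockA (K : ℕ) (x : Fin K → ℝ) (y γ : ℝ) :
    Matrix (Fin K ⊕ Unit) (Fin K ⊕ Unit) ℝ :=
  Matrix.fromBlocks (Matrix.vecMulVec x x) (Matrix.of fun i _ => -(y * x i))
    (Matrix.of fun _ j => -(y * x j)) (Matrix.of fun _ _ => γ⁻¹ ^ 2 + y ^ 2)

/-- The block matrix `[[x xᵀ, -c·x], [-c·xᵀ, c²]]`. -/
def blockB (K : ℕ) (x : Fin K → ℝ) (c : ℝ) :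
    Matrix (Fin K ⊕ Unit) (Fin K ⊕ Unit) ℝ :=
  Matrix.fromBlocks (Matrix.vecMulVec x x) (Matrix.of fun i _ => -(c * x i))
    (Matrix.of fun _ j => -(c * x j)) (Matrix.of fun _ _ => c ^ 2)

/-- The Hessian of the reparameterized log conditional likelihood of the truncated
regression model, `H(y, x; δ, γ)` with `v = γc - xᵀδ`. -/
def truncHess (K : ℕ) (c y : ℝ) (x δ : Fin K → ℝ) (γ : ℝ) :
    Matrix (Fin K ⊕ Unit) (Fin K ⊕ Unit) ℝ :=
  -(blockA K x y γ) +
    (mills (γ * c - dotp x δ) * (mills (γ * c - dotp x δ) - (γ * c - dotp x δ))) • blockB K x c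

/-- The Hessian of the reparameterized log conditional likelihood of the Tobit model,
`H(y, x, d; δ, γ)` with `v = γc - xᵀδ`. -/
def tobitHess (K : ℕ) (c y : ℝ) (x : Fin K → ℝ) (d : ℝ) (δ : Fin K → ℝ) (γ : ℝ) :
    Matrix (Fin K ⊕ Unit) (Fin K ⊕ Unit) ℝ :=
  -((1 - d) • blockA K x y γ) -
    (d * mills (-(γ * c - dotp x δ)) * (mills (-(γ * c - dotp x δ)) + (γ * c - dotp x δ))) •
      blockB K x c

/-- The score of the reparameterized log conditional likelihood of the Tobit model,
`s(y, x, d; δ, γ)` with `v = γc - xᵀδ`. -/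
def tobitScore (K : ℕ) (c y : ℝ) (x : Fin K → ℝ) (d : ℝ) (δ : Fin K → ℝ) (γ : ℝ) :
    Fin K ⊕ Unit → ℝ := fun j =>
  (1 - d) *
      Sum.elim (fun i => (γ * y - dotp x δ) * x i) (fun _ => 1 / γ - (γ * y - dotp x δ) * y) j
    + d * mills (-(γ * c - dotp x δ)) * Sum.elim (fun i => -x i) (fun _ => c) j

lemma gPDF_pos (t : ℝ) : 0 < gPDF t := by unfold gPDF; positivity

lemma gPDF_eq_gaussianPDFReal : gPDF = gaussianPDFReal 0 1 := by
  funext t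
  simp [gPDF, gaussianPDFReal]

lemma integrable_gPDF : Integrable gPDF := by
  rw [gPDF_eq_gaussianPDFReal]
  exact integrable_gaussianPDFReal 0 1

lemma integrable_mul_gPDF : Integrable fun t => t * gPDF t := by
  refine ((integrable_mul_exp_neg_mul_sq (b := 1 / 2) (by norm_num)).const_mul
    (√(2 * π))⁻¹).congr (Eventually.of_forall fun t => ?_)
  simp only [gPDF]
  ring_nf

lemma integrable_sq_mul_gPDF : Integrable fun t => t ^ 2 * gPDF t := by
  refine ((integrable_rpow_mul_exp_neg_mul_sq (b := 1 / 2) (by norm_num) (s := 2)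
    (by norm_num)).const_mul (√(2 * π))⁻¹).congr (Eventually.of_forall fun t => ?_)
  simp only [gPDF, rpow_ofNat]
  ring_nf

lemma hasDerivAt_gPDF (t : ℝ) : HasDerivAt gPDF (-(t * gPDF t)) t := by
  have h := (((hasDerivAt_pow 2 t).neg.div_const 2).exp).const_mul (√(2 * π))⁻¹
  refine h.congr_deriv ?_
  simp only [gPDF, Pi.neg_apply]
  push_cast
  ring

lemma hasDerivAt_mul_gPDF (t : ℝ) :
    HasDerivAt (fun t => t * gPDF t) (gPDF t - t ^ 2 * gPDF t) t :=
  ((hasDerivAt_id t).mul (hasDerivAt_gPDF t)).congr_deriv (by simp; ring)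

lemma integral_Ioi_gPDF (u : ℝ) : ∫ t in Ioi u, gPDF t = 1 - gCDF u := by
  have h := integral_add_compl (s := Iic u) measurableSet_Iic integrable_gPDF
  rw [compl_Iic, gPDF_eq_gaussianPDFReal, integral_gaussianPDFReal_eq_one 0 one_ne_zero] at h
  rw [gCDF, gPDF_eq_gaussianPDFReal]
  linarith

lemma integral_Ioi_mul_gPDF (u : ℝ) : ∫ t in Ioi u, t * gPDF t = gPDF u := by
  have h := integral_Ioi_of_hasDerivAt_of_tendsto (a := u)
    (hasDerivAt_gPDF u).continuousAt.continuousWithinAt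
    (fun t _ => hasDerivAt_gPDF t) integrable_mul_gPDF.neg.integrableOn
    (tendsto_zero_of_hasDerivAt_of_integrableOn_Ioi (a := u) (fun t _ => hasDerivAt_gPDF t)
      integrable_mul_gPDF.neg.integrableOn integrable_gPDF.integrableOn)
  rw [integral_neg] at h
  linarith

lemma integral_Ioi_sq_mul_gPDF (u : ℝ) :
    ∫ t in Ioi u, t ^ 2 * gPDF t = 1 - gCDF u + u * gPDF u := by
  have hint := (integrable_gPDF.sub integrable_sq_mul_gPDF).integrableOn (s := Ioi u)
  have h := integral_Ioi_of_hasDerivAt_of_tendsto (a := u)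
    (hasDerivAt_mul_gPDF u).continuousAt.continuousWithinAt
    (fun t _ => hasDerivAt_mul_gPDF t) hint
    (tendsto_zero_of_hasDerivAt_of_integrableOn_Ioi (a := u) (fun t _ => hasDerivAt_mul_gPDF t)
      hint integrable_mul_gPDF.integrableOn)
  rw [integral_sub integrable_gPDF.integrableOn integrable_sq_mul_gPDF.integrableOn,
    integral_Ioi_gPDF] at h
  linarith

lemma integral_Ioi_pos {f : ℝ → ℝ} {u : ℝ} (hf : IntegrableOn f (Ioi u))
    (hpos : ∀ t ∈ Ioi u, 0 < f t) : 0 < ∫ t in Ioi u, f t := by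
  rw [setIntegral_pos_iff_support_of_nonneg_ae
    ((ae_restrict_iff' measurableSet_Ioi).2 (Eventually.of_forall fun t ht => (hpos t ht).le)) hf,
    inter_eq_right.2 fun t ht => Function.mem_support.2 (hpos t ht).ne']
  simp

lemma one_sub_gCDF_pos (u : ℝ) : 0 < 1 - gCDF u := by
  rw [← integral_Ioi_gPDF]
  exact integral_Ioi_pos integrable_gPDF.integrableOn fun t _ => gPDF_pos t

lemma mills_pos (u : ℝ) : 0 < mills u := div_pos (gPDF_pos u) (one_sub_gCDF_pos u)

lemma lt_mills (u : ℝ) : u < mills u := by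
  have hint : Integrable fun t => t * gPDF t - u * gPDF t :=
    integrable_mul_gPDF.sub (integrable_gPDF.const_mul u)
  have h := integral_Ioi_pos (u := u) hint.integrableOn fun t ht => by
    rw [← sub_mul]
    exact mul_pos (sub_pos.2 ht) (gPDF_pos t)
  rw [integral_sub integrable_mul_gPDF.integrableOn (integrable_gPDF.const_mul u).integrableOn,
    integral_const_mul, integral_Ioi_gPDF, integral_Ioi_mul_gPDF] at h
  rw [mills, lt_div_iff₀ (one_sub_gCDF_pos u)]
  linarith

/-- The variance `1 - λ(u)(λ(u) - u)` of a standard normal truncated to `(u, ∞)` is nonnegative. -/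
lemma mills_mul_sub_le_one (u : ℝ) : mills u * (mills u - u) ≤ 1 := by
  have hQ := one_sub_gCDF_pos u
  have hm : mills u * (1 - gCDF u) = gPDF u := div_mul_cancel₀ _ hQ.ne'
  have h : 0 ≤ ∫ t in Ioi u,
      (t ^ 2 * gPDF t - 2 * mills u * (t * gPDF t) + mills u ^ 2 * gPDF t) :=
    setIntegral_nonneg measurableSet_Ioi fun t _ => by
      nlinarith [mul_nonneg (sq_nonneg (t - mills u)) (gPDF_pos t).le]
  have h₁ := (integrable_mul_gPDF.const_mul (2 * mills u)).integrableOn (s := Ioi u)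
  have h₂ := (integrable_gPDF.const_mul (mills u ^ 2)).integrableOn (s := Ioi u)
  have h₃ : IntegrableOn (fun t => t ^ 2 * gPDF t - 2 * mills u * (t * gPDF t)) (Ioi u) :=
    integrable_sq_mul_gPDF.integrableOn.sub h₁
  rw [integral_add h₃ h₂, integral_sub integrable_sq_mul_gPDF.integrableOn h₁,
    integral_const_mul, integral_const_mul, integral_Ioi_gPDF, integral_Ioi_mul_gPDF,
    integral_Ioi_sq_mul_gPDF, ← hm] at h
  refine le_of_mul_le_mul_right ?_ hQ
  nlinarith

lemma measurable_gPDF : Measurable gPDF :=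
  gPDF_eq_gaussianPDFReal ▸ measurable_gaussianPDFReal 0 1

lemma measurable_mills : Measurable mills := by
  have hmono : Monotone gCDF := fun s t hst =>
    setIntegral_mono_set integrable_gPDF.integrableOn
      (Eventually.of_forall fun x => (gPDF_pos x).le) (Iic_subset_Iic.2 hst).eventuallyLE
  exact measurable_gPDF.div (hmono.measurable.const_sub 1)

lemma dotProduct_fromBlocks_mulVec {K : ℕ} (x : Fin K → ℝ) (y q : ℝ) (z : Fin K ⊕ Unit → ℝ) :
    z ⬝ᵥ (Matrix.fromBlocks (Matrix.vecMulVec x x) (Matrix.of fun i _ => -(y * x i))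
      (Matrix.of fun _ j => -(y * x j)) (Matrix.of fun _ _ => q)).mulVec z =
    (dotp x (z ∘ Sum.inl) - y * z (Sum.inr ())) ^ 2 + (q - y ^ 2) * z (Sum.inr ()) ^ 2 := by
  have h₁ (i) : ∑ j, x i * x j * z (Sum.inl j) = x i * dotp x (z ∘ Sum.inl) := by
    simp only [dotp, Finset.mul_sum, mul_assoc, Function.comp_apply]
  have h₂ : ∑ j, y * x j * z (Sum.inl j) = y * dotp x (z ∘ Sum.inl) := by
    simp only [dotp, Finset.mul_sum, mul_assoc, Function.comp_apply]
  have h₃ (r : ℝ) : ∑ i, z (Sum.inl i) * (x i * r) = dotp x (z ∘ Sum.inl) * r := by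
    simp only [dotp, Finset.sum_mul, Function.comp_apply]
    exact Finset.sum_congr rfl fun i _ => by ring
  simp only [dotProduct, Matrix.mulVec, Fintype.sum_sum_type, Matrix.fromBlocks_apply₁₁,
    Matrix.fromBlocks_apply₁₂, Matrix.fromBlocks_apply₂₁, Matrix.fromBlocks_apply₂₂,
    Matrix.vecMulVec_apply, Matrix.of_apply, Finset.univ_unique, Finset.sum_singleton,
    neg_mul, Finset.sum_neg_distrib, h₁, h₂]
  have h₄ (i) : z (Sum.inl i) * (x i * dotp x (z ∘ Sum.inl) + -(y * x i * z (Sum.inr default))) =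
      z (Sum.inl i) * (x i * (dotp x (z ∘ Sum.inl) - y * z (Sum.inr default))) := by ring
  simp only [h₄, h₃]
  change _ = (_ - y * z (Sum.inr default)) ^ 2 + _ * z (Sum.inr default) ^ 2
  ring

/-- Quadratic form of the Tobit Hessian. -/
lemma dotProduct_tobitHess_mulVec {K : ℕ} (c y d γ : ℝ) (x δ : Fin K → ℝ)
    (z : Fin K ⊕ Unit → ℝ) :
    z ⬝ᵥ (tobitHess K c y x d δ γ).mulVec z =
      -((1 - d) * ((dotp x (z ∘ Sum.inl) - y * z (Sum.inr ())) ^ 2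
          + (γ⁻¹ * z (Sum.inr ())) ^ 2)
        + d * mills (-(γ * c - dotp x δ)) * (mills (-(γ * c - dotp x δ)) + (γ * c - dotp x δ)) *
          (dotp x (z ∘ Sum.inl) - c * z (Sum.inr ())) ^ 2) := by
  rw [tobitHess, Matrix.sub_mulVec, Matrix.neg_mulVec, Matrix.smul_mulVec, Matrix.smul_mulVec,
    dotProduct_sub, dotProduct_neg, dotProduct_smul, dotProduct_smul, blockA, blockB,
    dotProduct_fromBlocks_mulVec, dotProduct_fromBlocks_mulVec]
  simp only [smul_eq_mul]
  ring

lemma dotProduct_integral_mulVec {Ω n : Type*} [Fintype n] [MeasurableSpace Ω] {P : Measure Ω}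
    {M : Ω → Matrix n n ℝ} (hM : ∀ i j, Integrable (fun ω => M ω i j) P) (z : n → ℝ) :
    Integrable (fun ω => z ⬝ᵥ (M ω).mulVec z) P ∧
    z ⬝ᵥ (Matrix.of fun i j => ∫ ω, M ω i j ∂P).mulVec z = ∫ ω, z ⬝ᵥ (M ω).mulVec z ∂P := by
  have h₁ (i) : Integrable (fun ω => ∑ j, M ω i j * z j) P :=
    integrable_finsetSum _ fun j _ => (hM i j).mul_const _
  have h₂ (i) : Integrable (fun ω => z i * ∑ j, M ω i j * z j) P := (h₁ i).const_mul _
  simp only [dotProduct, Matrix.mulVec]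
  refine ⟨integrable_finsetSum _ fun i _ => h₂ i, ?_⟩
  rw [integral_finsetSum _ fun i _ => h₂ i]
  refine Finset.sum_congr rfl fun i _ => ?_
  rw [integral_const_mul, integral_finsetSum _ fun j _ => (hM i j).mul_const _]
  simp only [integral_mul_const, Matrix.of_apply]

lemma integrable_fromBlocks {Ω : Type*} [MeasurableSpace Ω] {P : Measure Ω} [IsFiniteMeasure P]
    {K : ℕ} {X : Ω → Fin K → ℝ} (hX : ∀ i, MemLp (fun ω => X ω i) 2 P) {Y : Ω → ℝ}
    (hY : MemLp Y 2 P) (q : ℝ) (i j : Fin K ⊕ Unit) :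
    Integrable (fun ω => Matrix.fromBlocks (Matrix.vecMulVec (X ω) (X ω))
      (Matrix.of fun i _ => -(Y ω * X ω i)) (Matrix.of fun _ j => -(Y ω * X ω j))
      (Matrix.of fun _ _ => q + Y ω ^ 2) i j) P := by
  rcases i with i | i <;> rcases j with j | j
  · exact (hX i).integrable_mul (hX j)
  · exact (hY.integrable_mul (hX i)).neg
  · exact (hY.integrable_mul (hX j)).neg
  · exact (integrable_const q).add hY.integrable_sq

lemma measurable_dotp {Ω : Type*} [MeasurableSpace Ω] {K : ℕ} {X : Ω → Fin K → ℝ}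
    (hX : Measurable X) (a : Fin K → ℝ) : Measurable fun ω => dotp (X ω) a := by
  unfold dotp
  fun_prop

lemma memLp_two_of_integrable_vnorm_sq {Ω : Type*} [MeasurableSpace Ω] {P : Measure Ω} {K : ℕ}
    {X : Ω → Fin K → ℝ} (hX : Measurable X) (hint : Integrable (fun ω => vnorm (X ω) ^ 2) P)
    (i : Fin K) : MemLp (fun ω => X ω i) 2 P := by
  have hXi : Measurable fun ω => X ω i := by fun_prop
  refine (memLp_two_iff_integrable_sq hXi.aestronglyMeasurable).2
    (hint.mono' (hXi.pow_const 2).aestronglyMeasurable (Eventually.of_forall fun ω => ?_))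
  rw [norm_of_nonneg (sq_nonneg _), vnorm, sq_sqrt (Finset.sum_nonneg fun _ _ => sq_nonneg _)]
  exact Finset.single_le_sum (f := fun j => X ω j ^ 2) (fun _ _ => sq_nonneg _)
    (Finset.mem_univ i)

/-- A nondegenerate Gaussian error independent of `U` pushes `U + ε` above any level with positive
probability. -/
lemma measure_lt_add_gaussian_ne_zero {Ω : Type*} [MeasurableSpace Ω] {P : Measure Ω}
    [IsProbabilityMeasure P] {U ε : Ω → ℝ} (hε : Measurable ε)
    {v : NNReal} (hv : v ≠ 0) (hgauss : P.map ε = gaussianReal 0 v) (hindep : IndepFun U ε P)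
    (c : ℝ) : P {ω | c < U ω + ε ω} ≠ 0 := by
  obtain ⟨n, hn⟩ : ∃ n : ℕ, P (U ⁻¹' Ioi (-(n : ℝ))) ≠ 0 := by
    by_contra! h
    have hU : (⋃ n : ℕ, U ⁻¹' Ioi (-(n : ℝ))) = univ := by
      refine eq_univ_of_forall fun ω => mem_iUnion.2 ?_
      obtain ⟨n, hn⟩ := exists_nat_gt (-U ω)
      exact ⟨n, neg_lt.1 hn⟩
    have := measure_iUnion_null h
    rw [hU, measure_univ] at this
    exact one_ne_zero this
  have hεpos : P (ε ⁻¹' Ioi (c + n)) ≠ 0 := by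
    rw [← Measure.map_apply hε measurableSet_Ioi, hgauss]
    intro h
    simpa using gaussianReal_absolutelyContinuous' 0 hv h
  intro h
  have hsub : U ⁻¹' Ioi (-(n : ℝ)) ∩ ε ⁻¹' Ioi (c + n) ⊆ {ω | c < U ω + ε ω} := by
    rintro ω ⟨h₁, h₂⟩
    simp only [mem_preimage, mem_Ioi, mem_ofPred_eq] at h₁ h₂ ⊢
    linarith
  have := measure_mono_null hsub h
  rw [hindep.measure_inter_preimage_eq_mul _ _ measurableSet_Ioi measurableSet_Ioi] at this
  exact (mul_ne_zero hn hεpos) this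

lemma eq_zero_of_dotp_ae_eq_zero {Ω : Type*} [MeasurableSpace Ω] {P : Measure Ω} {K : ℕ}
    {X : Ω → Fin K → ℝ} (hX : ∀ i, MemLp (fun ω => X ω i) 2 P)
    (hns : (Matrix.of fun i j => ∫ ω, X ω i * X ω j ∂P).det ≠ 0) {a : Fin K → ℝ}
    (ha : ∀ᵐ ω ∂P, dotp (X ω) a = 0) : a = 0 := by
  by_contra hne
  refine hns (Matrix.exists_mulVec_eq_zero_iff.1 ⟨a, hne, ?_⟩)
  funext i
  have hij (j) : Integrable (fun ω => X ω i * X ω j * a j) P :=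
    ((hX i).integrable_mul (hX j)).mul_const _
  simp only [Matrix.mulVec, dotProduct, Matrix.of_apply, Pi.zero_apply]
  simp only [← integral_mul_const]
  rw [← integral_finsetSum _ fun j _ => hij j]
  refine integral_eq_zero_of_ae (ha.mono fun ω hω => ?_)
  simp only [mul_assoc, ← Finset.mul_sum]
  exact mul_eq_zero_of_right _ hω

/-- Nonsingularity of the expected Tobit Hessian at the true parameters under
nonsingularity of `E[X Xᵀ]`. -/
theorem tobit_expected_hessian_nonsingular (K : ℕ) (hK : 0 < K) {Ω : Type*} [MeasurableSpace Ω]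
    (P : Measure Ω) [IsProbabilityMeasure P]
    (X : Ω → Fin K → ℝ) (hX : Measurable X) (ε : Ω → ℝ) (hε : Measurable ε)
    (σ₀ : ℝ) (hσ : 0 < σ₀)
    (hgauss : Measure.map ε P = gaussianReal 0 ⟨σ₀ ^ 2, sq_nonneg σ₀⟩)
    (hindep : IndepFun X ε P)
    (β₀ : Fin K → ℝ) (c : ℝ)
    (Y : Ω → ℝ) (hY : ∀ ω, Y ω = max (dotp (X ω) β₀ + ε ω) c)
    (D : Ω → ℝ) (hD : ∀ ω, D ω = if dotp (X ω) β₀ + ε ω ≤ c then 1 else 0)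
    (δ₀ : Fin K → ℝ) (hδ₀ : δ₀ = fun i => β₀ i / σ₀) (γ₀ : ℝ) (hγ₀ : γ₀ = 1 / σ₀)
    (hint : Integrable (fun ω => vnorm (X ω) ^ 2) P)
    (hns : (Matrix.of fun i j => ∫ ω, X ω i * X ω j ∂P).det ≠ 0) :
    (Matrix.of fun i j =>
        ∫ ω, tobitHess K c (Y ω) (X ω) (D ω) δ₀ γ₀ i j ∂P).det ≠ 0 := by
  have hXL := memLp_two_of_integrable_vnorm_sq hX hint
  have hL := measurable_dotp hX β₀
  have hεL : MemLp ε 2 P := by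
    have h := memLp_id_gaussianReal (μ := 0) (v := ⟨σ₀ ^ 2, sq_nonneg σ₀⟩) 2
    rw [← hgauss, memLp_map_measure_iff aestronglyMeasurable_id hε.aemeasurable] at h
    exact h
  have hYL : MemLp Y 2 P := by
    rw [funext hY]
    exact ((memLp_finsetSum _ fun i _ => (hXL i).mul_const (β₀ i)).add hεL).sup (memLp_const c)
  have hD01 (ω) : D ω = 0 ∨ D ω = 1 := by
    rw [hD]
    split_ifs <;> simp
  have hDm : Measurable D := by
    rw [funext hD]
    exact Measurable.ite (measurableSet_le (hL.add hε) measurable_const) measurable_const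
      measurable_const
  have hκm : Measurable fun ω => D ω * mills (-(γ₀ * c - dotp (X ω) δ₀)) *
      (mills (-(γ₀ * c - dotp (X ω) δ₀)) + (γ₀ * c - dotp (X ω) δ₀)) := by
    have hv := (measurable_dotp hX δ₀).const_sub (γ₀ * c)
    have hm := measurable_mills.comp hv.neg
    exact (hDm.mul hm).mul (hm.add hv)
  have hκpos (v : ℝ) : 0 < mills (-v) * (mills (-v) + v) :=
    mul_pos (mills_pos _) (by linarith [lt_mills (-v)])
  have hκle (v : ℝ) : mills (-v) * (mills (-v) + v) ≤ 1 := by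
    simpa using mills_mul_sub_le_one (-v)
  have hH (i j) : Integrable (fun ω => tobitHess K c (Y ω) (X ω) (D ω) δ₀ γ₀ i j) P := by
    have hA := integrable_fromBlocks hXL hYL (γ₀⁻¹ ^ 2) i j
    have hB := integrable_fromBlocks hXL (memLp_const c) 0 i j
    simp only [zero_add] at hB
    refine (hA.bdd_mul (c := 1) (hDm.const_sub 1).aestronglyMeasurable
      (Eventually.of_forall fun ω => ?_)).neg.sub
      (hB.bdd_mul (c := 1) hκm.aestronglyMeasurable (Eventually.of_forall fun ω => ?_))
    · rcases hD01 ω with h | h <;> simp [h]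
    · rcases hD01 ω with h | h
      · simp [h]
      · rw [h, one_mul, norm_of_nonneg (hκpos _).le]
        exact hκle _
  intro hdet
  obtain ⟨z, hz, hMz⟩ := Matrix.exists_mulVec_eq_zero_iff.2 hdet
  obtain ⟨hqint, hq⟩ := dotProduct_integral_mulVec hH z
  rw [hMz, dotProduct_zero] at hq
  simp only [dotProduct_tobitHess_mulVec] at hq hqint
  rw [integral_neg, eq_comm, neg_eq_zero,
    integral_eq_zero_iff_of_nonneg ?_ (by simpa using hqint.fun_neg)] at hq
  swap
  · intro ω
    rcases hD01 ω with h | h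
    · simp only [h, Pi.zero_apply, sub_zero, one_mul, zero_mul, add_zero]
      positivity
    · simp only [h, Pi.zero_apply, one_mul, sub_self, zero_mul, zero_add]
      exact mul_nonneg (hκpos _).le (sq_nonneg _)
  have hσ2 : (⟨σ₀ ^ 2, sq_nonneg σ₀⟩ : NNReal) ≠ 0 := by
    simpa [← NNReal.coe_ne_zero] using hσ.ne'
  have hγ : γ₀⁻¹ ≠ 0 := by simpa [hγ₀] using hσ.ne'
  have hD0 {ω} (h : c < dotp (X ω) β₀ + ε ω) : D ω = 0 := by
    rw [hD, if_neg h.not_ge]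
  have hb : z (Sum.inr ()) = 0 := by
    by_contra hb
    refine measure_lt_add_gaussian_ne_zero hε hσ2 hgauss
      (hindep.comp (measurable_dotp measurable_id β₀) measurable_id) c
      (measure_mono_null ?_ hq)
    intro ω hω h
    replace hω : c < dotp (X ω) β₀ + ε ω := hω
    have hpos : 0 < (γ₀⁻¹ * z (Sum.inr ())) ^ 2 := by positivity
    simp only [mem_ofPred_eq, hD0 hω, Pi.zero_apply] at h
    nlinarith [sq_nonneg (dotp (X ω) (z ∘ Sum.inl) - Y ω * z (Sum.inr ()))]
  have ha : z ∘ Sum.inl = 0 := by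
    refine eq_zero_of_dotp_ae_eq_zero hXL hns (hq.mono fun ω hω => ?_)
    rcases hD01 ω with h | h
    · simpa [h, hb] using hω
    · simpa only [h, hb, Pi.zero_apply, one_mul, mul_zero, sub_zero, sub_self, zero_mul, zero_add,
        mul_eq_zero, (hκpos (γ₀ * c - dotp (X ω) δ₀)).ne', false_or, pow_eq_zero_iff two_ne_zero]
        using hω
  refine hz (funext fun i => ?_)
  rcases i with i | i
  · exact congrFun ha i
  · exact hb
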